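/- Let X be a first countable, locally compact, paracompact Hausdorff topological space, f : X → X a topologically Anosov homeomorphism, and R a chain component of f. Then R is both open and closed in the chain recurrent set CR(f) (with its subspace topology). -/

import Mathlib

open Set Topology

namespace TopAnosovPaper

variable {X Y : Type*}

section Defs

variable [TopologicalSpace X]

/-- The `n`-th iterate (n ∈ ℤ) of a homeomorphism, as a function. -/
def iter (f : X ≃ₜ X) (n : ℤ) : X → X := ⇑(f.toEquiv ^ n)

/-- `N` is an expansive neighborhood for `f`: a closed neighborhood of the
diagonal such that any two distinct points are eventually separated by `F = f × f`. -/
def IsExpansiveNbhd (f : X ≃ₜ X) (N : Set (X × X)) : Prop :=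
  IsClosed N ∧ N ∈ nhdsSet (Set.diagonal X) ∧
    ∀ x y : X, x ≠ y → ∃ n : ℤ, (iter f n x, iter f n y) ∉ N

/-- `f` is topologically expansive. -/
def TopExpansive (f : X ≃ₜ X) : Prop := ∃ N : Set (X × X), IsExpansiveNbhd f N

/-- A `D`-pseudo-orbit: a bi-infinite sequence with `(f x_{i-1}, x_i) ∈ D`. -/
def IsPseudoOrbit (f : X ≃ₜ X) (D : Set (X × X)) (x : ℤ → X) : Prop :=
  ∀ i : ℤ, (f (x (i - 1)), x i) ∈ D

/-- `y` `E`-traces the bi-infinite sequence `x`. -/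
def Traces (f : X ≃ₜ X) (E : Set (X × X)) (y : X) (x : ℤ → X) : Prop :=
  ∀ i : ℤ, (iter f i y, x i) ∈ E

/-- `f` has the topological shadowing property. -/
def TopShadowing (f : X ≃ₜ X) : Prop :=
  ∀ E ∈ nhdsSet (Set.diagonal X), ∃ D ∈ nhdsSet (Set.diagonal X),
    ∀ x : ℤ → X, IsPseudoOrbit f D x → ∃ y : X, Traces f E y x

/-- `f` is topologically Anosov: expansive with the shadowing property. -/
def TopAnosov (f : X ≃ₜ X) : Prop := TopExpansive f ∧ TopShadowing f

/-- An `A`-chain from `x` to `y` (of length `n ≥ 1`). -/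
def IsChainFromTo (f : X ≃ₜ X) (A : Set (X × X)) (x y : X) : Prop :=
  ∃ n : ℕ, 1 ≤ n ∧ ∃ c : ℕ → X, c 0 = x ∧ c n = y ∧
    ∀ i : ℕ, 1 ≤ i → i ≤ n → (f (c (i - 1)), c i) ∈ A

/-- `x ∼ y`: for every neighborhood `A` of the diagonal there is an `A`-chain
from `x` to `y` and one from `y` to `x`. -/
def ChainRel (f : X ≃ₜ X) (x y : X) : Prop :=
  ∀ A ∈ nhdsSet (Set.diagonal X), IsChainFromTo f A x y ∧ IsChainFromTo f A y x

/-- The chain recurrent set. -/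
def CR (f : X ≃ₜ X) : Set X := {x | ChainRel f x x}

/-- `R` is a chain component: an equivalence class of `∼` restricted to `CR f`. -/
def IsChainComponent (f : X ≃ₜ X) (R : Set X) : Prop :=
  ∃ x ∈ CR f, R = {y | y ∈ CR f ∧ ChainRel f x y}

/-- The non-wandering set of `f`. -/
def NonWandering (f : X ≃ₜ X) : Set X :=
  {x | ∀ G : Set X, IsOpen G → x ∈ G → ∃ n : ℕ, 0 < n ∧ (iter f n '' G ∩ G).Nonempty}

/-- `x` is a periodic point of `f`. -/
def Periodic (f : X ≃ₜ X) (x : X) : Prop := ∃ n : ℕ, 0 < n ∧ iter f n x = x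

/-- The set of periodic points of `f`. -/
def Per (f : X ≃ₜ X) : Set X := {x | Periodic f x}

/-- A relation `M ⊆ X × X` is proper if `M[S]` is compact for every compact `S`. -/
def IsProperRel (M : Set (X × X)) : Prop :=
  ∀ S : Set X, IsCompact S → IsCompact {y : X | ∃ x ∈ S, (x, y) ∈ M}

/-- A set `U ⊆ X × X` is wide if `U ∪ (S × X) = X × X` for some compact `S`. -/
def IsWide (U : Set (X × X)) : Prop :=
  ∃ S : Set X, IsCompact S ∧ U ∪ (S ×ˢ (Set.univ : Set X)) = Set.univ

/-- `E` is symmetric. -/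
def SymmRel (E : Set (X × X)) : Prop := ∀ p : X × X, p ∈ E → (p.2, p.1) ∈ E

/-- `E² = {(x,y) : ∃ z, (x,z) ∈ E ∧ (z,y) ∈ E}`. -/
def sq (E : Set (X × X)) : Set (X × X) := {p : X × X | ∃ z : X, (p.1, z) ∈ E ∧ (z, p.2) ∈ E}

/-- The local stable set of `x` relative to `B`. -/
def WsLoc (f : X ≃ₜ X) (B : Set (X × X)) (x : X) : Set X :=
  {y | ∀ i : ℤ, 0 ≤ i → (iter f i x, iter f i y) ∈ B}

/-- The local unstable set of `x` relative to `B`. -/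
def WuLoc (f : X ≃ₜ X) (B : Set (X × X)) (x : X) : Set X :=
  {y | ∀ i : ℤ, i ≤ 0 → (iter f i x, iter f i y) ∈ B}

/-- The stable set of `x`. -/
def Ws (f : X ≃ₜ X) (x : X) : Set X :=
  {y | ∀ B ∈ nhdsSet (Set.diagonal X), ∃ n : ℕ, ∀ i : ℤ, (n : ℤ) ≤ i →
    (iter f i x, iter f i y) ∈ B}

/-- The unstable set of `x`. -/
def Wu (f : X ≃ₜ X) (x : X) : Set X :=
  {y | ∀ B ∈ nhdsSet (Set.diagonal X), ∃ n : ℕ, ∀ i : ℤ, i ≤ -(n : ℤ) →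
    (iter f i x, iter f i y) ∈ B}

/-- `f` restricted to `R` is topologically transitive: for any nonempty
relatively open subsets `G, H` of `R` there is `n ∈ ℕ` with `f^n(G) ∩ H ≠ ∅`. -/
def TransitiveOn (f : X ≃ₜ X) (R : Set X) : Prop :=
  ∀ G H : Set X, (∃ U : Set X, IsOpen U ∧ G = U ∩ R) → (∃ V : Set X, IsOpen V ∧ H = V ∩ R) →
    G.Nonempty → H.Nonempty → ∃ n : ℕ, (iter f n '' G ∩ H).Nonempty

/-- `V_N(A)`: pairs whose first `N` forward and backward iterates all lie in `A`. -/
def VN (f : X ≃ₜ X) (A : Set (X × X)) (N : ℕ) : Set (X × X) :=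
  {p : X × X | ∀ n : ℤ, |n| ≤ (N : ℤ) → (iter f n p.1, iter f n p.2) ∈ A}

/-- The `n`-th power (n ∈ ℕ) of a homeomorphism. -/
def hpowNat (f : X ≃ₜ X) : ℕ → X ≃ₜ X
  | 0 => Homeomorph.refl X
  | n + 1 => (hpowNat f n).trans f

/-- The `k`-th power (k ∈ ℤ) of a homeomorphism, as a homeomorphism. -/
def hpow (f : X ≃ₜ X) : ℤ → X ≃ₜ X
  | Int.ofNat n => hpowNat f n
  | Int.negSucc n => (hpowNat f (n + 1)).symm

end Defs

end TopAnosovPaper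

open TopAnosovPaper

namespace TopAnosovPaper

section Iterates

variable {X : Type*} [TopologicalSpace X] (f : X ≃ₜ X)

theorem iter_zero (x : X) : iter f 0 x = x := rfl

theorem iter_add (m n : ℤ) (x : X) : iter f (m + n) x = iter f m (iter f n x) := by
  simp [iter, zpow_add]

theorem iter_one (x : X) : iter f 1 x = f x := by
  simp [iter]

theorem apply_iter_sub_one (n : ℤ) (x : X) : f (iter f (n - 1) x) = iter f n x := by
  rw [← iter_one f, ← iter_add]
  congr 1
  ring

theorem continuous_iter (n : ℤ) : Continuous (iter f n) := by
  induction n with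
  | zero => exact continuous_id
  | succ n ih =>
    refine (f.continuous.comp ih).congr fun x => ?_
    simpa using apply_iter_sub_one f (n + 1) x
  | pred n ih =>
    refine (f.symm.continuous.comp ih).congr fun x => ?_
    simp [← apply_iter_sub_one f (-n) x]

theorem iter_mul_natCast_of_fixed {m : ℤ} {p : X} (hp : iter f m p = p) (j : ℕ) :
    iter f (m * j) p = p := by
  induction j with
  | zero => simp [iter_zero]
  | succ j ih =>
    rw [Nat.cast_succ, mul_add, mul_one, iter_add, hp, ih]

theorem iter_neg_of_fixed {m : ℤ} {p : X} (hp : iter f m p = p) : iter f (-m) p = p := by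
  conv_lhs => rw [← hp, ← iter_add, neg_add_cancel, iter_zero]

end Iterates

section Chains

open Relation

variable {X : Type*} [TopologicalSpace X] {f : X ≃ₜ X} {A : Set (X × X)}

theorem isChainFromTo_iff_transGen {x y : X} :
    IsChainFromTo f A x y ↔ TransGen (fun a b => (f a, b) ∈ A) x y := by
  constructor
  · rintro ⟨n, hn, c, rfl, rfl, hc⟩
    induction n, hn using Nat.le_induction with
    | base => exact .single (hc 1 le_rfl le_rfl)
    | succ n hn ih =>
      exact (ih fun i h1 h2 => hc i h1 (by lia)).tail (hc (n + 1) (by lia) le_rfl)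
  · intro h
    induction h with
    | @single b h =>
      refine ⟨1, le_rfl, fun i => if i = 0 then x else b, by simp, by simp, fun i h1 h2 => ?_⟩
      obtain rfl : i = 1 := le_antisymm h2 h1
      simpa using h
    | @tail b d _ h ih =>
      obtain ⟨n, hn, c, h0, hcn, hc⟩ := ih
      refine ⟨n + 1, by lia, fun i => if i ≤ n then c i else d, by simpa using h0, by simp,
        fun i h1 h2 => ?_⟩
      rcases h2.lt_or_eq with h3 | rfl
      · have h4 : i ≤ n := by lia
        have h5 : i - 1 ≤ n := by lia
        simpa [h4, h5] using hc i h1 h4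
      · simpa [hcn] using h

theorem ChainRel.symm {x y : X} (h : ChainRel f x y) : ChainRel f y x :=
  fun A hA => (h A hA).symm

theorem ChainRel.trans {x y z : X} (h : ChainRel f x y) (h' : ChainRel f y z) :
    ChainRel f x z := by
  intro A hA
  have h1 := h A hA
  have h2 := h' A hA
  simp only [isChainFromTo_iff_transGen] at *
  exact ⟨h1.1.trans h2.1, h2.2.trans h1.2⟩

theorem diag_mem (hA : A ∈ nhdsSet (diagonal X)) (x : X) : (x, x) ∈ A :=
  subset_of_mem_nhdsSet hA (mem_diagonal x)

theorem reflTransGen_iter (hA : A ∈ nhdsSet (diagonal X)) (z : X) {k l : ℤ} (hkl : k ≤ l) :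
    ReflTransGen (fun a b => (f a, b) ∈ A) (iter f k z) (iter f l z) := by
  induction l, hkl using Int.leInduction with
  | base => exact .refl
  | succ l _ ih =>
    refine ih.tail ?_
    have h := apply_iter_sub_one f (l + 1) z
    rw [add_sub_cancel_right] at h
    rw [h]
    exact diag_mem hA _

theorem transGen_of_iter_mem (hA : A ∈ nhdsSet (diagonal X)) {z p : X} {n : ℤ} (hn : 1 ≤ n)
    (h : (iter f n z, p) ∈ A) : TransGen (fun a b => (f a, b) ∈ A) z p := by
  refine .tail' (reflTransGen_iter hA z (k := 0) (l := n - 1) (by lia)) ?_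
  rwa [apply_iter_sub_one]

theorem transGen_of_apply_iter_neg_mem (hA : A ∈ nhdsSet (diagonal X)) {q z : X} {n : ℤ}
    (hn : 1 ≤ n) (h : (f q, f (iter f (-n) z)) ∈ A) :
    TransGen (fun a b => (f a, b) ∈ A) q z := by
  refine .head' (b := iter f (-n + 1) z) ?_
    (reflTransGen_iter hA z (k := -n + 1) (l := 0) (by lia))
  rw [← apply_iter_sub_one]
  simpa using h

end Chains

section Anosov

open Relation Filter

variable {X : Type*} [TopologicalSpace X]

/-- In a paracompact Hausdorff space every cover by neighborhoods is refined by the slices of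
some neighborhood of the diagonal. -/
theorem exists_nhdsSet_diagonal_slices_subset [ParacompactSpace X] [T2Space X]
    (s : X → Set X) (hs : ∀ x, s x ∈ 𝓝 x) :
    ∃ E ∈ nhdsSet (diagonal X), ∀ c, ∃ x, ∀ a, (a, c) ∈ E → a ∈ s x := by
  obtain ⟨u, huo, hu, hlf, hus⟩ := precise_refinement (fun x => interior (s x))
    (fun _ => isOpen_interior)
    (iUnion_eq_univ_iff.2 fun x => ⟨x, mem_interior_iff_mem_nhds.2 (hs x)⟩)
  obtain ⟨v, hv, hvc, hvu⟩ := exists_iUnion_eq_closed_subset huo hlf.point_finite hu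
  refine ⟨{p | ∀ i, p.2 ∈ v i → p.1 ∈ u i}, mem_nhdsSet_iff_forall.2 ?_, fun c => ?_⟩
  · rintro ⟨x, y⟩ hxy
    obtain rfl : x = y := hxy
    obtain ⟨t, ht, hfin⟩ := hlf x
    have hsnd : Tendsto Prod.snd (𝓝 (x, x)) (𝓝 x) := continuous_snd.tendsto (x, x)
    have hfst : Tendsto Prod.fst (𝓝 (x, x)) (𝓝 x) := continuous_fst.tendsto (x, x)
    have h1 : ∀ i, ∀ᶠ p : X × X in 𝓝 (x, x), p.2 ∈ v i → p.1 ∈ u i := by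
      intro i
      by_cases hx : x ∈ v i
      · filter_upwards [hfst ((huo i).mem_nhds (hvu i hx))] with p hp _ using hp
      · filter_upwards [hsnd ((hvc i).isOpen_compl.mem_nhds hx)] with p hp h using absurd h hp
    filter_upwards [hsnd ht, (eventually_all_finite hfin).2 fun i _ => h1 i] with p hp h i hi
    exact h i ⟨p.2, hvu i hi, hp⟩ hi
  · obtain ⟨i, hi⟩ := iUnion_eq_univ_iff.1 hv c
    exact ⟨i, fun a ha => interior_subset (hus i (ha i hi))⟩

/-- Slices of `E` are contained in compact sets whose squares lie in `N`. -/
def SlicesCompactIn (E N : Set (X × X)) : Prop :=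
  ∀ c, ∃ K : Set X, IsCompact K ∧ K ×ˢ K ⊆ N ∧ ∀ a, (a, c) ∈ E → a ∈ K

theorem exists_slicesCompactIn [LocallyCompactSpace X] [ParacompactSpace X] [T2Space X]
    {N : Set (X × X)} (hN : N ∈ nhdsSet (diagonal X)) :
    ∃ E ∈ nhdsSet (diagonal X), SlicesCompactIn E N := by
  have h : ∀ x : X, ∃ K ∈ 𝓝 x, IsCompact K ∧ K ×ˢ K ⊆ N := by
    intro x
    have hx := mem_nhdsSet_iff_forall.1 hN (x, x) rfl
    obtain ⟨t, t', ht, hxt, ht', hxt', htt⟩ := mem_nhds_prod_iff'.1 hx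
    obtain ⟨K, hK, hKs, hKc⟩ := local_compact_nhds
      (inter_mem (ht.mem_nhds hxt) (ht'.mem_nhds hxt'))
    exact ⟨K, hK, hKc, fun p hp => htt ⟨(hKs hp.1).1, (hKs hp.2).2⟩⟩
  choose K hK hKc hKN using h
  obtain ⟨E, hE, hEK⟩ := exists_nhdsSet_diagonal_slices_subset K hK
  exact ⟨E, hE, fun c => (hEK c).imp' K fun x hx => ⟨hKc x, hKN x, hx⟩⟩

variable {f : X ≃ₜ X} {E N : Set (X × X)}

theorem IsExpansiveNbhd.eq_of_forall (hN : IsExpansiveNbhd f N) {x y : X}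
    (h : ∀ n, (iter f n x, iter f n y) ∈ N) : x = y := by
  by_contra hxy
  obtain ⟨n, hn⟩ := hN.2.2 x y hxy
  exact hn (h n)

theorem exists_periodic_mem_nhds [T2Space X] (hN : IsExpansiveNbhd f N) (hf : TopShadowing f)
    (hE : E ∈ nhdsSet (diagonal X)) (hEN : SlicesCompactIn E N) {x : X} (hx : x ∈ CR f)
    {U : Set X} (hU : U ∈ 𝓝 x) : ∃ p ∈ U, ∃ m : ℤ, 1 ≤ m ∧ iter f m p = p := by
  have hG : {p : X × X | p.2 = x → p.1 ∈ U} ∈ nhdsSet (diagonal X) := by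
    refine mem_nhdsSet_iff_forall.2 ?_
    rintro ⟨a, b⟩ hab
    obtain rfl : a = b := hab
    by_cases ha : a = x
    · subst ha
      filter_upwards [continuous_fst.tendsto (a, a) hU] with p hp _ using hp
    · filter_upwards [continuous_snd.tendsto (a, a) (isOpen_ne.mem_nhds ha)] with p hp h
        using absurd h hp
  obtain ⟨D, hD, hDs⟩ := hf _ (inter_mem hE hG)
  obtain ⟨n, hn, c, hc0, hcn, hc⟩ := (hx D hD).1
  have hn' : (n : ℤ) ≠ 0 := by lia
  obtain ⟨z, hz⟩ := hDs (fun i => c (i % n).toNat) fun i => by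
    have h0 := Int.emod_nonneg i hn'
    have hlt := Int.emod_lt_of_pos i (b := (n : ℤ)) (by lia)
    obtain hi | hi := h0.eq_or_lt
    · have h1 : (i - 1) % n = n - 1 := by
        rw [Int.sub_emod, ← hi]
        rw [show (0 - 1 % (n : ℤ)) % n = (-1 + n * 1) % n by
          rw [Int.add_mul_emod_self_left, Int.sub_emod_emod]; rfl]
        exact Int.emod_eq_of_lt (by lia) (by lia) |>.trans (by ring)
      have h2 := hc n hn le_rfl
      rw [hcn, ← hc0] at h2
      dsimp only
      rw [h1, ← hi, Int.toNat_zero]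
      convert h2 using 4
      lia
    · have h1 : (i - 1) % n = i % n - 1 := by
        rw [← Int.emod_sub_emod]
        exact Int.emod_eq_of_lt (by lia) (by lia)
      have h2 := hc (i % n).toNat (by lia) (by lia)
      dsimp only
      rw [h1]
      convert h2 using 4
      lia
  refine ⟨z, ?_, n, by lia, ?_⟩
  · have h := (hz 0).2
    exact h (by simpa using hc0)
  · refine (hN.eq_of_forall fun i => ?_)
    have h1 := (hz i).1
    have h2 := (hz (i + n)).1
    simp only [Int.add_emod_right] at h2
    obtain ⟨K, -, hKN, hK⟩ := hEN (c (i % n).toNat)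
    rw [← iter_add]
    exact hKN ⟨hK _ h2, hK _ h1⟩

theorem mapClusterPt_iter [T2Space X] (hN : IsExpansiveNbhd f N)
    (hE : E ∈ nhdsSet (diagonal X)) (hEN : SlicesCompactIn E N) {p z : X} (t : ℕ → ℤ)
    (ht : ∀ i, ∀ᶠ j in atTop, (iter f (i + t j) z, iter f i p) ∈ E) :
    MapClusterPt p atTop fun j => iter f (t j) z := by
  obtain ⟨K, hKc, -, hK⟩ := hEN p
  have h0 : ∀ᶠ j in atTop, iter f (t j) z ∈ K := by
    filter_upwards [ht 0] with j hj
    exact hK _ (by simpa [iter_zero] using hj)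
  obtain ⟨w, -, hw⟩ := hKc.exists_mapClusterPt_of_frequently h0.frequently
  have hwp : w = p := by
    refine hN.eq_of_forall fun i => ?_
    obtain ⟨L, hLc, hLN, hL⟩ := hEN (iter f i p)
    refine hLN ⟨?_, hL _ (diag_mem hE _)⟩
    by_contra hwL
    have hev := (continuous_iter f i).continuousAt (hLc.isClosed.isOpen_compl.mem_nhds hwL)
    obtain ⟨j, hj1, hj2⟩ := ((hw.frequently hev).and_eventually (ht i)).exists
    exact hj1 (hL _ (by rwa [iter_add] at hj2))
  rwa [hwp] at hw

/-- Periodic points that are close relative to a shadowing neighborhood are linked by chains: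
a point tracing the past of one and the future of the other is asymptotic to both orbits. -/
theorem transGen_of_periodic [T2Space X] (hN : IsExpansiveNbhd f N)
    (hE : E ∈ nhdsSet (diagonal X)) (hEN : SlicesCompactIn E N) {D : Set (X × X)}
    (hD : D ∈ nhdsSet (diagonal X))
    (hDs : ∀ x : ℤ → X, IsPseudoOrbit f D x → ∃ y : X, Traces f E y x)
    {p q : X} (hqp : (q, p) ∈ D) {m k : ℤ} (hm : 1 ≤ m) (hk : 1 ≤ k) (hp : iter f m p = p)
    (hq : iter f k q = q) {A : Set (X × X)} (hA : A ∈ nhdsSet (diagonal X)) :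
    TransGen (fun a b => (f a, b) ∈ A) q p := by
  obtain ⟨z, hz⟩ := hDs (fun i => if i < 0 then iter f i q else iter f i p) fun i => by
    rcases lt_trichotomy i 0 with hi | rfl | hi
    · have h1 : i - 1 < 0 := by lia
      simp only [hi, h1, if_true, apply_iter_sub_one]
      exact diag_mem hD _
    · have h1 : (0 : ℤ) - 1 < 0 := by lia
      simpa only [h1, lt_irrefl, if_true, if_false, apply_iter_sub_one, iter_zero] using hqp
    · have h1 : ¬ i - 1 < 0 := by lia
      have h2 : ¬ i < 0 := by lia
      simp only [h1, h2, if_false, apply_iter_sub_one]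
      exact diag_mem hD _
  have hfwd : MapClusterPt p atTop fun j : ℕ => iter f (m * j) z := by
    refine mapClusterPt_iter hN hE hEN _ fun i => ?_
    filter_upwards [eventually_ge_atTop i.natAbs] with j hj
    have h1 : (j : ℤ) ≤ m * j := le_mul_of_one_le_left (by lia) hm
    have h2 : ¬ i + m * j < 0 := by lia
    have h3 := hz (i + m * j)
    simp only [h2, if_false] at h3
    rwa [iter_add f i _ p, iter_mul_natCast_of_fixed f hp] at h3
  have hbwd : MapClusterPt q atTop fun j : ℕ => iter f (-k * j) z := by
    refine mapClusterPt_iter hN hE hEN _ fun i => ?_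
    filter_upwards [eventually_gt_atTop i.natAbs] with j hj
    have h1 : (j : ℤ) ≤ k * j := le_mul_of_one_le_left (by lia) hk
    have h2 : i + -k * j < 0 := by rw [neg_mul]; lia
    have h3 := hz (i + -k * j)
    simp only [h2, if_true] at h3
    rwa [iter_add f i _ q, iter_mul_natCast_of_fixed f (iter_neg_of_fixed f hq)] at h3
  have hzp : TransGen (fun a b => (f a, b) ∈ A) z p := by
    have hev : ∀ᶠ a in 𝓝 p, (a, p) ∈ A :=
      (Continuous.prodMk_left p).continuousAt (mem_nhdsSet_iff_forall.1 hA (p, p) rfl)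
    obtain ⟨j, hj1, hj2⟩ := ((hfwd.frequently hev).and_eventually (eventually_ge_atTop 1)).exists
    exact transGen_of_iter_mem hA (by nlinarith) hj1
  have hqz : TransGen (fun a b => (f a, b) ∈ A) q z := by
    have hev : ∀ᶠ a in 𝓝 q, (f q, f a) ∈ A :=
      (continuous_const.prodMk f.continuous).continuousAt
        (mem_nhdsSet_iff_forall.1 hA (f q, f q) rfl)
    obtain ⟨j, hj1, hj2⟩ := ((hbwd.frequently hev).and_eventually (eventually_ge_atTop 1)).exists
    rw [neg_mul] at hj1
    exact transGen_of_apply_iter_neg_mem hA (by nlinarith) hj1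
  exact hqz.trans hzp

theorem exists_nhds_forall_chainRel [LocallyCompactSpace X] [ParacompactSpace X] [T2Space X]
    (hf : TopAnosov f) (x : X) :
    ∃ U ∈ 𝓝 x, ∀ a ∈ U, ∀ b ∈ U, a ∈ CR f → b ∈ CR f → ChainRel f a b := by
  obtain ⟨⟨N, hN⟩, hsh⟩ := hf
  obtain ⟨E, hE, hEN⟩ := exists_slicesCompactIn hN.2.1
  obtain ⟨D, hD, hDs⟩ := hsh E hE
  obtain ⟨U, V, hUo, hxU, hVo, hxV, hUV⟩ :=
    mem_nhds_prod_iff'.1 (mem_nhdsSet_iff_forall.1 hD (x, x) rfl)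
  have main : ∀ a ∈ U ∩ V, ∀ b ∈ U ∩ V, a ∈ CR f → b ∈ CR f →
      ∀ A ∈ nhdsSet (diagonal X), TransGen (fun a b => (f a, b) ∈ A) a b := by
    intro a ha b hb haC hbC A hA
    have hW := (hUo.inter hVo)
    have hfa : ∀ᶠ p in 𝓝 a, (f a, f p) ∈ A :=
      (continuous_const.prodMk f.continuous).continuousAt
        (mem_nhdsSet_iff_forall.1 hA (f a, f a) rfl)
    have hfb : ∀ᶠ q in 𝓝 b, (q, b) ∈ A :=
      (Continuous.prodMk_left b).continuousAt (mem_nhdsSet_iff_forall.1 hA (b, b) rfl)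
    obtain ⟨p, ⟨hpW, hpA⟩, m, hm, hp⟩ := exists_periodic_mem_nhds hN hsh hE hEN haC
      (inter_mem (hW.mem_nhds ha) hfa)
    obtain ⟨q, ⟨hqW, hqA⟩, k, hk, hq⟩ := exists_periodic_mem_nhds hN hsh hE hEN hbC
      (inter_mem (hW.mem_nhds hb) hfb)
    have hap : TransGen (fun a b => (f a, b) ∈ A) a p :=
      transGen_of_apply_iter_neg_mem hA hm (by rwa [iter_neg_of_fixed f hp])
    have hqb : TransGen (fun a b => (f a, b) ∈ A) q b :=
      transGen_of_iter_mem hA hk (by rwa [hq])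
    exact (hap.trans (transGen_of_periodic hN hE hEN hD hDs (hUV ⟨hpW.1, hqW.2⟩) hk hm hq hp
      hA)).trans hqb
  refine ⟨U ∩ V, (hUo.inter hVo).mem_nhds ⟨hxU, hxV⟩, fun a ha b hb haC hbC A hA => ?_⟩
  simp only [isChainFromTo_iff_transGen]
  exact ⟨main a ha b hb haC hbC A hA, main b hb a ha hbC haC A hA⟩

end Anosov

end TopAnosovPaper

/-- A chain component of a topologically Anosov homeomorphism is both open
and closed in the chain recurrent set with its subspace topology. -/
theorem component_clopen_in_CR {X : Type*} [TopologicalSpace X]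
    [FirstCountableTopology X] [LocallyCompactSpace X] [ParacompactSpace X] [T2Space X]
    (f : X ≃ₜ X) (hf : TopAnosov f) (R : Set X) (hR : IsChainComponent f R) :
    IsOpen (Subtype.val ⁻¹' R : Set (CR f)) ∧
    IsClosed (Subtype.val ⁻¹' R : Set (CR f)) := by
  obtain ⟨x, -, rfl⟩ := hR
  refine ⟨isOpen_iff_mem_nhds.2 fun y hy => ?_,
    ⟨isOpen_iff_mem_nhds.2 fun y (hy : ¬ (_ ∧ _)) => ?_⟩⟩
  all_goals
    obtain ⟨U, hU, h⟩ := exists_nhds_forall_chainRel hf (y : X)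
    filter_upwards [continuous_subtype_val.continuousAt hU] with w hw
    have hyw := h y (mem_of_mem_nhds hU) w hw y.2 w.2
  · exact ⟨w.2, hy.2.trans hyw⟩
  · exact fun hxw => hy ⟨y.2, hxw.2.trans hyw.symm⟩
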